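/- Let (𝒫, ℒ) be a linear space with dim(𝒫, ℒ) ≥ 2, and let ℳ ⊆ ℒ be a maximal related set that is not a star of lines. Then the subspace ℰ spanned by the union of the lines of ℳ is a plane, and ℰ = x ∨ y for all distinct x, y ∈ ℳ. -/

import Mathlib

/-- A linear space: a point set `P` together with a set of lines (subsets of `P`),
each line having at least two points, and any two distinct points lying on
exactly one line. -/
structure LinearSpace (P : Type*) where
  lines : Set (Set P)
  two_points : ∀ l ∈ lines, ∃ A B : P, A ≠ B ∧ A ∈ l ∧ B ∈ l
  unique_line : ∀ A B : P, A ≠ B → ∃! l, l ∈ lines ∧ A ∈ l ∧ B ∈ l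

namespace LinearSpace

variable {P : Type*} (LS : LinearSpace P)

/-- A subspace: a subset containing, with any two of its distinct points,
the line joining them. -/
def IsSubspace (S : Set P) : Prop :=
  ∀ l ∈ LS.lines, ∀ A ∈ l, ∀ B ∈ l, A ≠ B → A ∈ S → B ∈ S → l ⊆ S

/-- The span of a subset: the intersection of all subspaces containing it. -/
def span (S : Set P) : Set P :=
  ⋂₀ {T | LS.IsSubspace T ∧ S ⊆ T}

/-- The dimension of a subset `S` (intended for subspaces):
`min {#X - 1 | X ⊆ S, span X = S}` as an extended natural number. -/
noncomputable def sdim (S : Set P) : ℕ∞ :=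
  sInf {d : ℕ∞ | ∃ X : Set P, X ⊆ S ∧ LS.span X = S ∧ d = X.encard - 1}

/-- The dimension of the linear space: `min {#X - 1 | span X = P}`. -/
noncomputable def dim : ℕ∞ := LS.sdim Set.univ

/-- A plane is a 2-dimensional subspace. -/
def IsPlane (E : Set P) : Prop := LS.IsSubspace E ∧ LS.sdim E = 2

/-- A generalized projective space: every plane is a generalized projective
plane, i.e. any two distinct lines contained in a common plane meet. -/
def IsGenProjSpace : Prop :=
  ∀ E : Set P, LS.IsPlane E →
    ∀ l ∈ LS.lines, ∀ m ∈ LS.lines, l ⊆ E → m ⊆ E → l ≠ m → (l ∩ m).Nonempty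

/-- A related set: a set of lines which pairwise meet. -/
def IsRelatedSet (N : Set (Set P)) : Prop :=
  N ⊆ LS.lines ∧ ∀ a ∈ N, ∀ b ∈ N, (a ∩ b).Nonempty

/-- A maximal related set: a related set maximal with respect to inclusion. -/
def IsMaxRelatedSet (M : Set (Set P)) : Prop :=
  LS.IsRelatedSet M ∧ ∀ N, LS.IsRelatedSet N → M ⊆ N → N = M

/-- The star of lines with vertex `A`: all lines through `A`. -/
def star (A : P) : Set (Set P) := {l | l ∈ LS.lines ∧ A ∈ l}

/-- The pencil of planes with axis `a`: all planes containing `a`. -/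
def pencil (a : Set P) : Set (Set P) := {E | LS.IsPlane E ∧ a ⊆ E}

/-- A collineation: a bijection of the point sets mapping each line onto a
line, and whose inverse does likewise. -/
def IsCollineation {P' : Type*} (LS' : LinearSpace P') (κ : P → P') : Prop :=
  Function.Bijective κ ∧ (∀ l ∈ LS.lines, κ '' l ∈ LS'.lines) ∧
    (∀ l' ∈ LS'.lines, κ ⁻¹' l' ∈ LS.lines)

end LinearSpace

namespace LinearSpace

variable {P : Type*} (LS : LinearSpace P)

theorem subset_span (S : Set P) : S ⊆ LS.span S :=
  Set.subset_sInter fun _ h => h.2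

variable {LS}

theorem IsSubspace.span_subset {S T : Set P} (hT : LS.IsSubspace T) (h : S ⊆ T) :
    LS.span S ⊆ T :=
  Set.sInter_subset_of_mem ⟨hT, h⟩

variable (LS) in
theorem isSubspace_span (S : Set P) : LS.IsSubspace (LS.span S) :=
  fun l hl A hA B hB hAB hAS hBS _ hC T hT =>
    hT.1 l hl A hA B hB hAB (hAS T hT) (hBS T hT) hC

theorem line_eq {l m : Set P} (hl : l ∈ LS.lines) (hm : m ∈ LS.lines) {A B : P} (hAB : A ≠ B)
    (hAl : A ∈ l) (hBl : B ∈ l) (hAm : A ∈ m) (hBm : B ∈ m) : l = m :=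
  (LS.unique_line A B hAB).unique ⟨hl, hAl, hBl⟩ ⟨hm, hAm, hBm⟩

theorem isSubspace_of_mem_lines {l : Set P} (hl : l ∈ LS.lines) : LS.IsSubspace l :=
  fun _ hm _ hA _ hB hAB hAl hBl => (line_eq hm hl hAB hA hB hAl hBl).subset

/-- A set with at most two points is contained in a line, as soon as there are lines at all. -/
theorem exists_line_superset {x X : Set P} (hx : x ∈ LS.lines) (hX : X.encard ≤ 2) :
    ∃ l ∈ LS.lines, X ⊆ l := by
  have key : ∀ A B : P, ∃ l ∈ LS.lines, A ∈ l ∧ B ∈ l := by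
    intro A B
    by_cases hAB : A = B
    · subst hAB
      obtain ⟨C, D, hCD, -, -⟩ := LS.two_points x hx
      have : ∃ E, A ≠ E := by
        by_cases h : A = C
        · exact ⟨D, h ▸ hCD⟩
        · exact ⟨C, h⟩
      obtain ⟨E, hE⟩ := this
      obtain ⟨l, ⟨hl, hA, -⟩, -⟩ := LS.unique_line A E hE
      exact ⟨l, hl, hA, hA⟩
    · obtain ⟨l, ⟨hl, h⟩, -⟩ := LS.unique_line A B hAB
      exact ⟨l, hl, h⟩
  rcases X.eq_empty_or_nonempty with rfl | ⟨A, hA⟩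
  · exact ⟨x, hx, Set.empty_subset _⟩
  by_cases h : ∃ B ∈ X, A ≠ B
  · obtain ⟨B, hB, hAB⟩ := h
    obtain ⟨l, hl, hAl, hBl⟩ := key A B
    refine ⟨l, hl, fun C hC => ?_⟩
    by_contra hCl
    have hsub : ({A, B, C} : Set P) ⊆ X := by
      rintro _ (rfl | rfl | rfl) <;> assumption
    have h3 : ({A, B, C} : Set P).encard = 3 :=
      Set.encard_eq_three.2 ⟨A, B, C, hAB, fun h => hCl (h ▸ hAl), fun h => hCl (h ▸ hBl), rfl⟩
    have h32 := (Set.encard_le_encard hsub).trans hX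
    rw [h3] at h32
    exact absurd h32 (by decide)
  · push Not at h
    obtain ⟨l, hl, hAl, -⟩ := key A A
    exact ⟨l, hl, fun B hB => h B hB ▸ hAl⟩

theorem two_le_sdim {E x : Set P} (hx : x ∈ LS.lines) (hE : ∀ l ∈ LS.lines, ¬ E ⊆ l) :
    2 ≤ LS.sdim E := by
  refine le_sInf ?_
  rintro _ ⟨X, -, hXE, rfl⟩
  by_contra! h
  have h2 : X.encard ≤ 2 := by
    have := Order.le_of_lt_add_one (show X.encard - 1 < 1 + 1 by rwa [one_add_one_eq_two])
    rwa [tsub_le_iff_right, one_add_one_eq_two] at this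
  obtain ⟨l, hl, hXl⟩ := exists_line_superset hx h2
  exact hE l hl (hXE ▸ (isSubspace_of_mem_lines hl).span_subset hXl)

/-- Two distinct intersecting lines span a plane. -/
theorem isPlane_span_union {x y : Set P} (hx : x ∈ LS.lines) (hy : y ∈ LS.lines) (hxy : x ≠ y)
    (h : (x ∩ y).Nonempty) : LS.IsPlane (LS.span (x ∪ y)) := by
  obtain ⟨A, hAx, hAy⟩ := h
  have other : ∀ l ∈ LS.lines, ∃ B ∈ l, A ≠ B := by
    intro l hl
    obtain ⟨C, D, hCD, hC, hD⟩ := LS.two_points l hl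
    by_cases h : A = C
    · exact ⟨D, hD, h ▸ hCD⟩
    · exact ⟨C, hC, h⟩
  obtain ⟨B, hB, hAB⟩ := other x hx
  obtain ⟨C, hC, hAC⟩ := other y hy
  have hBC : B ≠ C := fun h => hxy (line_eq hx hy hAB hAx hB hAy (h ▸ hC))
  refine ⟨LS.isSubspace_span _, le_antisymm (sInf_le ⟨{A, B, C}, ?_, ?_, ?_⟩) ?_⟩
  · rintro _ (rfl | rfl | rfl)
    exacts [LS.subset_span _ (.inl hAx), LS.subset_span _ (.inl hB), LS.subset_span _ (.inr hC)]
  · have hsub := LS.subset_span {A, B, C}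
    refine Set.Subset.antisymm ((LS.isSubspace_span _).span_subset ?_)
      ((LS.isSubspace_span _).span_subset (Set.union_subset ?_ ?_))
    · rintro _ (rfl | rfl | rfl)
      exacts [LS.subset_span _ (.inl hAx), LS.subset_span _ (.inl hB), LS.subset_span _ (.inr hC)]
    · exact LS.isSubspace_span _ x hx A hAx B hB hAB (hsub (by simp)) (hsub (by simp))
    · exact LS.isSubspace_span _ y hy A hAy C hC hAC (hsub (by simp)) (hsub (by simp))
  · rw [Set.encard_eq_three.2 ⟨A, B, C, hAB, hAC, hBC, rfl⟩]
    rfl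
  · refine two_le_sdim hx fun l hl hEl => hxy ?_
    have hsub := (LS.subset_span _).trans hEl
    rw [line_eq hx hl hAB hAx hB (hsub (.inl hAx)) (hsub (.inl hB)),
      line_eq hy hl hAC hAy hC (hsub (.inl hAx)) (hsub (.inr hC))]

theorem nonempty_of_mem_lines {l : Set P} (hl : l ∈ LS.lines) : l.Nonempty :=
  let ⟨A, _, _, hA, _⟩ := LS.two_points l hl
  ⟨A, hA⟩

theorem lines_nonempty_of_two_le_dim (hdim : 2 ≤ LS.dim) : LS.lines.Nonempty := by
  by_contra! hempty
  have hsub : (Set.univ : Set P).Subsingleton := by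
    intro A _ B _
    by_contra hAB
    obtain ⟨l, ⟨hl, -⟩, -⟩ := LS.unique_line A B hAB
    exact hempty.subset hl
  have hle : LS.dim ≤ (Set.univ : Set P).encard - 1 :=
    sInf_le ⟨Set.univ, subset_rfl, Set.univ_subset_iff.1 (LS.subset_span _), rfl⟩
  have h0 : (Set.univ : Set P).encard - 1 = 0 :=
    tsub_eq_zero_of_le (Set.encard_le_one_iff_subsingleton.2 hsub)
  rw [h0] at hle
  exact absurd (hdim.trans hle) (by decide)

/-- The lines of a maximal related set that is not a star have no common point. -/
theorem IsMaxRelatedSet.exists_notMem {M : Set (Set P)} (hM : LS.IsMaxRelatedSet M)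
    (hns : ∀ A : P, M ≠ LS.star A) (A : P) : ∃ z ∈ M, A ∉ z := by
  by_contra! h
  exact hns A (hM.2 (LS.star A) ⟨fun _ hl => hl.1, fun _ ha _ hb => ⟨A, ha.2, hb.2⟩⟩
    fun l hl => ⟨hM.1.1 hl, h l hl⟩).symm

theorem IsMaxRelatedSet.nonempty {M : Set (Set P)} (hM : LS.IsMaxRelatedSet M)
    (h : LS.lines.Nonempty) : M.Nonempty := by
  by_contra! hempty
  obtain ⟨l, hl⟩ := h
  have : {l} = M := by
    refine hM.2 {l} ⟨Set.singleton_subset_iff.2 hl, ?_⟩ (hempty ▸ Set.empty_subset _)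
    rintro _ rfl _ rfl
    simpa using nonempty_of_mem_lines hl
  exact Set.singleton_ne_empty l (this.trans hempty)

theorem IsMaxRelatedSet.span_sUnion_eq {M : Set (Set P)} (hM : LS.IsMaxRelatedSet M)
    (hns : ∀ A : P, M ≠ LS.star A) {x y : Set P} (hx : x ∈ M) (hy : y ∈ M) (hxy : x ≠ y) :
    LS.span (⋃₀ M) = LS.span (x ∪ y) := by
  have hsub := LS.subset_span (x ∪ y)
  have hE := LS.isSubspace_span (x ∪ y)
  obtain ⟨A, hAx, hAy⟩ := hM.1.2 x hx y hy
  have transversal : ∀ z ∈ M, A ∉ z → z ⊆ LS.span (x ∪ y) := by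
    intro z hz hAz
    obtain ⟨B, hBx, hBz⟩ := hM.1.2 x hx z hz
    obtain ⟨C, hCy, hCz⟩ := hM.1.2 y hy z hz
    have hBC : B ≠ C := by
      rintro rfl
      exact hxy (line_eq (hM.1.1 hx) (hM.1.1 hy) (ne_of_mem_of_not_mem hBz hAz) hBx hAx hCy hAy)
    exact hE z (hM.1.1 hz) B hBz C hCz hBC (hsub (.inl hBx)) (hsub (.inr hCy))
  refine Set.Subset.antisymm (hE.span_subset (Set.sUnion_subset fun w hw => ?_))
    ((LS.isSubspace_span _).span_subset ((Set.union_subset (Set.subset_sUnion_of_mem hx)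
      (Set.subset_sUnion_of_mem hy)).trans (LS.subset_span _)))
  by_cases hAw : A ∈ w
  · obtain ⟨z, hz, hAz⟩ := hM.exists_notMem hns A
    obtain ⟨D, hDw, hDz⟩ := hM.1.2 w hw z hz
    exact hE w (hM.1.1 hw) A hAw D hDw (fun h => hAz (h ▸ hDz)) (hsub (.inl hAx))
      (transversal z hz hAz hDz)
  · exact transversal w hw hAw

end LinearSpace

/-- If `dim (P, L) ≥ 2` and `M` is a maximal related set different from a
star of lines, then the subspace spanned by the lines of `M` is a plane `E`
with `E = x ∨ y` for all distinct `x, y ∈ M`. -/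
theorem maxRelatedSet_not_star_spans_plane
    {P : Type*} (LS : LinearSpace P) (hdim : 2 ≤ LS.dim)
    (M : Set (Set P)) (hM : LS.IsMaxRelatedSet M)
    (hns : ∀ A : P, M ≠ LS.star A) :
    LS.IsPlane (LS.span (⋃₀ M)) ∧
      ∀ x ∈ M, ∀ y ∈ M, x ≠ y → LS.span (⋃₀ M) = LS.span (x ∪ y) := by
  refine ⟨?_, fun x hx y hy => hM.span_sUnion_eq hns hx hy⟩
  obtain ⟨x, hx⟩ := hM.nonempty (LinearSpace.lines_nonempty_of_two_le_dim hdim)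
  obtain ⟨A, hA⟩ := LinearSpace.nonempty_of_mem_lines (hM.1.1 hx)
  obtain ⟨y, hy, hAy⟩ := hM.exists_notMem hns A
  have hxy : x ≠ y := fun h => hAy (h ▸ hA)
  rw [hM.span_sUnion_eq hns hx hy hxy]
  exact LinearSpace.isPlane_span_union (hM.1.1 hx) (hM.1.1 hy) hxy (hM.1.2 x hx y hy)
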